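/- Let 𝒵 = ℝ^d, let ‖·‖ be a norm on ℝ^d with dual norm ‖θ‖_* = sup{⟨θ, x⟩ : ‖x‖ ≤ 1}, let p ≥ 1, and let c(z, ẑ) = ‖z − ẑ‖^p. Let L : ℝ → (−∞, ∞] be proper and upper semicontinuous with L(s) ≤ C(1 + |s|^p) for some C ≥ 0 and all s ∈ ℝ. Fix θ ∈ ℝ^d, suppose ẑ ↦ L(⟨θ, ẑ⟩) is P̂-integrable, and let ε > 0. Then sup_{Q ∈ B_ε(P̂)} ∫ L(⟨θ, z⟩) dQ(z) = inf_{λ ≥ 0} ( λ ε ‖θ‖_*^p + ∫ L_p(⟨θ, ẑ⟩, λ) dP̂(ẑ) ), where L_p(s, λ) = sup_{s' ∈ ℝ} L(s') − λ |s − s'|^p. -/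

import Mathlib

open MeasureTheory ENNReal Set

noncomputable section

/-- The set of couplings of two measures. -/
def couplings {α : Type*} [MeasurableSpace α] (Q P : Measure α) : Set (Measure (α × α)) :=
  {π | π.map Prod.fst = Q ∧ π.map Prod.snd = P}

/-- The optimal transport discrepancy `d_c(Q, P) = inf_π ∫ c dπ`. -/
def OTDiscrepancy {α : Type*} [MeasurableSpace α] (c : α → α → ℝ≥0∞) (Q P : Measure α) :
    ℝ≥0∞ :=
  ⨅ π ∈ couplings Q P, ∫⁻ p, c p.1 p.2 ∂π

/-- The optimal transport ambiguity set `B_ε(P) = {Q : d_c(Q, P) ≤ ε}`. -/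
def ambiguitySet {α : Type*} [MeasurableSpace α] (c : α → α → ℝ≥0∞)
    (P : ProbabilityMeasure α) (ε : ℝ) : Set (ProbabilityMeasure α) :=
  {Q | OTDiscrepancy c Q.toMeasure P.toMeasure ≤ ENNReal.ofReal ε}

/-- The `[0,∞]`-valued positive part of an extended real number. -/
def erealPos (x : EReal) : ℝ≥0∞ := if x = ⊤ then ⊤ else ENNReal.ofReal x.toReal

/-- The `(−∞,∞]`-valued integral of a `(−∞,∞]`-valued function. -/
def eint {α : Type*} [MeasurableSpace α] (μ : Measure α) (f : α → EReal) : EReal :=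
  ((∫⁻ a, erealPos (f a) ∂μ : ℝ≥0∞) : EReal) - ((∫⁻ a, erealPos (-(f a)) ∂μ : ℝ≥0∞) : EReal)

/-- The inner product `⟨x, y⟩ = Σ_i x_i y_i` on `ℝ^d`. -/
def dotp {d : ℕ} (x y : Fin d → ℝ) : ℝ := ∑ i, x i * y i

/-- The dual norm `‖θ‖_* = sup {⟨θ, x⟩ : ‖x‖ ≤ 1}` of a norm `N` on `ℝ^d`. -/
def dualNorm {d : ℕ} (N : (Fin d → ℝ) → ℝ) (θ : Fin d → ℝ) : ℝ :=
  sSup {r : ℝ | ∃ x : Fin d → ℝ, N x ≤ 1 ∧ r = dotp θ x}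

/-- The `p`-th envelope `L_p(s, λ) = sup_{s'} L(s') − λ|s − s'|^p` of `L`. -/
def pEnvelope (L : ℝ → EReal) (p : ℝ) (s lam : ℝ) : EReal :=
  ⨆ s' : ℝ, L s' - ((lam * |s - s'| ^ p : ℝ) : EReal)

theorem erealPos_coe (r : ℝ) : erealPos (r : EReal) = ENNReal.ofReal r := by
  simp [erealPos]

theorem erealPos_neg_coe (r : ℝ) : erealPos (-(r : EReal)) = ENNReal.ofReal (-r) := by
  rw [← EReal.coe_neg, erealPos_coe]

theorem measurable_erealPos : Measurable erealPos :=
  Measurable.ite (measurableSet_singleton _) measurable_const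
    (ENNReal.measurable_ofReal.comp measurable_ereal_toReal)

section eint

variable {α β : Type*} [MeasurableSpace α] [MeasurableSpace β] {μ : Measure α}

theorem eint_coe {g : α → ℝ} (hg : Integrable g μ) :
    eint μ (fun a => (g a : EReal)) = ((∫ a, g a ∂μ : ℝ) : EReal) := by
  have hpos : ∫⁻ a, ENNReal.ofReal (g a) ∂μ ≠ ⊤ := hg.lintegral_lt_top.ne
  have hneg : ∫⁻ a, ENNReal.ofReal (-g a) ∂μ ≠ ⊤ := hg.neg.lintegral_lt_top.ne
  simp only [eint, erealPos_coe, erealPos_neg_coe]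
  rw [integral_eq_lintegral_pos_part_sub_lintegral_neg_part hg, EReal.coe_sub,
    EReal.coe_ennreal_toReal hpos, EReal.coe_ennreal_toReal hneg]

theorem eint_map {φ : β → α} {ν : Measure β} (hφ : Measurable φ) {f : α → EReal}
    (hf : Measurable f) : eint (ν.map φ) f = eint ν (fun b => f (φ b)) := by
  unfold eint
  rw [lintegral_map (f := fun a => erealPos (f a)) (measurable_erealPos.comp hf) hφ,
    lintegral_map (f := fun a => erealPos (-(f a))) (measurable_erealPos.comp hf.neg) hφ]

theorem erealPos_add_le {x : EReal} {r : ℝ} {k : ℝ≥0∞} (h : x ≤ (r : EReal) + (k : EReal)) :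
    erealPos x + ENNReal.ofReal (-r) ≤ ENNReal.ofReal r + (k + erealPos (-x)) := by
  rcases eq_or_ne k ⊤ with rfl | hk
  · simp
  lift k to NNReal using hk
  induction x with
  | bot => simp [erealPos]
  | top =>
    have : ((r : EReal) + ((k : ℝ≥0∞) : EReal)) ≠ ⊤ := by
      rw [EReal.coe_nnreal_eq_coe_real, ← EReal.coe_add]; exact EReal.coe_ne_top _
    exact absurd (top_le_iff.1 h) this
  | coe y =>
    rw [EReal.coe_nnreal_eq_coe_real, ← EReal.coe_add, EReal.coe_le_coe_iff] at h
    rw [erealPos_coe, erealPos_neg_coe]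
    have hk : (k : ℝ≥0∞) = ENNReal.ofReal k := by simp
    rw [hk]
    have e : ∀ a : ℝ, ENNReal.ofReal a = ENNReal.ofReal (max a 0) := by simp
    rw [e y, e (-r), e r, e (-y), ← ENNReal.ofReal_add (by simp) (by simp),
      ← ENNReal.ofReal_add (by simp) (by simp), ← ENNReal.ofReal_add (by simp) (by positivity)]
    apply ENNReal.ofReal_le_ofReal
    rcases max_cases y 0 with h1 | h1 <;> rcases max_cases (-y) 0 with h2 | h2 <;>
      rcases max_cases r 0 with h3 | h3 <;> rcases max_cases (-r) 0 with h4 | h4 <;> linarith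

theorem eint_le_integral_add_lintegral {f : α → EReal} {g : α → ℝ} {k : α → ℝ≥0∞}
    (hg : Integrable g μ) (hk : AEMeasurable k μ)
    (h : ∀ᵐ a ∂μ, f a ≤ (g a : EReal) + (k a : EReal)) :
    eint μ f ≤ ((∫ a, g a ∂μ : ℝ) : EReal) + ((∫⁻ a, k a ∂μ : ℝ≥0∞) : EReal) := by
  rcases eq_or_ne (∫⁻ a, erealPos (-(f a)) ∂μ) ⊤ with hn | hn
  · simp [eint, hn]
  rcases eq_or_ne (∫⁻ a, k a ∂μ) ⊤ with hkt | hkt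
  · simp [hkt]
  have hpos : ∫⁻ a, ENNReal.ofReal (g a) ∂μ ≠ ⊤ := hg.lintegral_lt_top.ne
  have hneg : ∫⁻ a, ENNReal.ofReal (-g a) ∂μ ≠ ⊤ := hg.neg.lintegral_lt_top.ne
  have key : (∫⁻ a, erealPos (f a) ∂μ) + ∫⁻ a, ENNReal.ofReal (-g a) ∂μ ≤
      (∫⁻ a, ENNReal.ofReal (g a) ∂μ) + ((∫⁻ a, k a ∂μ) + ∫⁻ a, erealPos (-(f a)) ∂μ) := by
    have hgm : AEMeasurable (fun a => ENNReal.ofReal (-g a)) μ :=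
      hg.aemeasurable.neg.ennreal_ofReal
    rw [← lintegral_add_right' _ hgm, ← lintegral_add_left' hk,
      ← lintegral_add_left' hg.aemeasurable.ennreal_ofReal]
    exact lintegral_mono_ae (h.mono fun a ha => erealPos_add_le ha)
  rw [integral_eq_lintegral_pos_part_sub_lintegral_neg_part hg]
  unfold eint
  generalize (∫⁻ a, erealPos (f a) ∂μ) = A at *
  generalize (∫⁻ a, erealPos (-(f a)) ∂μ) = B at *
  generalize (∫⁻ a, ENNReal.ofReal (g a) ∂μ) = P at *
  generalize (∫⁻ a, ENNReal.ofReal (-g a) ∂μ) = M at *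
  generalize (∫⁻ a, k a ∂μ) = K at *
  have hA : A ≠ ⊤ := by
    rintro rfl
    simp [hpos, hkt, hn] at key
  lift A to NNReal using hA
  lift B to NNReal using hn
  lift P to NNReal using hpos
  lift M to NNReal using hneg
  lift K to NNReal using hkt
  have key' : (A : ℝ) + M ≤ P + (K + B) := by exact_mod_cast key
  simp only [EReal.coe_nnreal_eq_coe_real, ENNReal.coe_toReal]
  rw [← EReal.coe_add, ← EReal.coe_sub, EReal.coe_le_coe_iff]
  linarith

theorem exists_integrable_ae_eq {f : α → EReal} (hf : Measurable f)
    (hpos : ∫⁻ a, erealPos (f a) ∂μ ≠ ⊤) (hneg : ∫⁻ a, erealPos (-(f a)) ∂μ ≠ ⊤) :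
    ∃ g : α → ℝ, Integrable g μ ∧ ∀ᵐ a ∂μ, f a = (g a : EReal) := by
  have hmp : Measurable fun a => erealPos (f a) := measurable_erealPos.comp hf
  have hmn : Measurable fun a => erealPos (-(f a)) := measurable_erealPos.comp hf.neg
  have hae : ∀ᵐ a ∂μ, f a = ((f a).toReal : EReal) := by
    filter_upwards [ae_lt_top hmp hpos, ae_lt_top hmn hneg] with a h1 h2
    refine (EReal.coe_toReal ?_ ?_).symm <;> intro h <;> simp [h, erealPos] at h1 h2
  refine ⟨fun a => (f a).toReal, ⟨hf.ereal_toReal.aestronglyMeasurable, ?_⟩, hae⟩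
  rw [hasFiniteIntegral_iff_norm]
  refine lt_of_le_of_lt (lintegral_mono_ae (g := fun a => erealPos (f a) + erealPos (-(f a))) ?_) ?_
  · filter_upwards [hae] with a ha
    rw [ha, erealPos_coe, erealPos_neg_coe, EReal.toReal_coe, Real.norm_eq_abs]
    rcases le_total 0 (f a).toReal with h | h
    · rw [abs_of_nonneg h]; exact le_self_add
    · rw [abs_of_nonpos h]; exact le_add_self
  · rw [lintegral_add_left hmp]
    exact (ENNReal.add_ne_top.2 ⟨hpos, hneg⟩).lt_top

end eint

section norm

variable {d : ℕ} {N : (Fin d → ℝ) → ℝ}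

theorem dotp_add (θ x y : Fin d → ℝ) : dotp θ (x + y) = dotp θ x + dotp θ y := by
  simp [dotp, mul_add, Finset.sum_add_distrib]

theorem dotp_sub (θ x y : Fin d → ℝ) : dotp θ (x - y) = dotp θ x - dotp θ y := by
  simp [dotp, mul_sub, Finset.sum_sub_distrib]

theorem dotp_smul (θ : Fin d → ℝ) (a : ℝ) (x : Fin d → ℝ) : dotp θ (a • x) = a * dotp θ x := by
  simp only [dotp, Finset.mul_sum, Pi.smul_apply, smul_eq_mul]
  exact Finset.sum_congr rfl fun i _ => by ring

theorem continuous_dotp (θ : Fin d → ℝ) : Continuous (dotp θ) := by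
  unfold dotp
  fun_prop

theorem norm_fun_nonneg (hN0 : ∀ x, N x = 0 ↔ x = 0) (hNhom : ∀ (a : ℝ) x, N (a • x) = |a| * N x)
    (hNtri : ∀ x y, N (x + y) ≤ N x + N y) (x : Fin d → ℝ) : 0 ≤ N x := by
  have h1 := hNtri x ((-1 : ℝ) • x)
  have h2 := hNhom (-1) x
  have h3 : N (x + (-1 : ℝ) • x) = 0 := (hN0 _).2 (by simp)
  rw [h2, h3] at h1
  norm_num at h1
  linarith

theorem norm_fun_continuous (hNhom : ∀ (a : ℝ) x, N (a • x) = |a| * N x)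
    (hNtri : ∀ x y, N (x + y) ≤ N x + N y) : Continuous N := by
  have hconv : ConvexOn ℝ univ N := by
    refine ⟨convex_univ, fun x _ y _ a b ha hb _ => ?_⟩
    calc N (a • x + b • y) ≤ N (a • x) + N (b • y) := hNtri _ _
      _ = a • N x + b • N y := by
        rw [hNhom, hNhom, abs_of_nonneg ha, abs_of_nonneg hb, smul_eq_mul, smul_eq_mul]
  exact continuousOn_univ.1 (hconv.continuousOn isOpen_univ)

theorem norm_fun_unitBall_isCompact (hN0 : ∀ x, N x = 0 ↔ x = 0)
    (hNhom : ∀ (a : ℝ) x, N (a • x) = |a| * N x)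
    (hNtri : ∀ x y, N (x + y) ≤ N x + N y) : IsCompact {x | N x ≤ 1} := by
  have hcont := norm_fun_continuous hNhom hNtri
  refine Metric.isCompact_of_isClosed_isBounded (isClosed_le hcont continuous_const) ?_
  rcases (Metric.sphere (0 : Fin d → ℝ) 1).eq_empty_or_nonempty with he | hne
  · refine (Metric.isBounded_iff_subset_closedBall 0).2 ⟨0, fun x _ => ?_⟩
    by_contra hx
    have hx' : ‖x‖ ≠ 0 := by
      simpa using hx
    have : ‖x‖⁻¹ • x ∈ Metric.sphere (0 : Fin d → ℝ) 1 := by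
      simp [norm_smul, hx']
    simp [he] at this
  · obtain ⟨y, hy, hmin⟩ := (isCompact_sphere (0 : Fin d → ℝ) 1).exists_isMinOn hne
      hcont.continuousOn
    have hy0 : y ≠ 0 := by
      rintro rfl
      simp at hy
    have hm : 0 < N y := lt_of_le_of_ne (norm_fun_nonneg hN0 hNhom hNtri y)
      fun h => hy0 ((hN0 y).1 h.symm)
    refine (Metric.isBounded_iff_subset_closedBall 0).2 ⟨(N y)⁻¹, fun x hx => ?_⟩
    rw [mem_closedBall_zero_iff]
    rcases eq_or_ne x 0 with rfl | hx0
    · simpa using hm.le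
    have hxn : 0 < ‖x‖ := norm_pos_iff.2 hx0
    have hsph : ‖x‖⁻¹ • x ∈ Metric.sphere (0 : Fin d → ℝ) 1 := by
      simp [norm_smul, hxn.ne']
    have h1 : N y ≤ N (‖x‖⁻¹ • x) := hmin hsph
    rw [hNhom, abs_of_pos (inv_pos.2 hxn), ← div_eq_inv_mul, le_div_iff₀ hxn] at h1
    have hx1 : N x ≤ 1 := hx
    rw [← one_div, le_div_iff₀ hm]
    linarith

theorem exists_dualNorm_eq (hN0 : ∀ x, N x = 0 ↔ x = 0)
    (hNhom : ∀ (a : ℝ) x, N (a • x) = |a| * N x)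
    (hNtri : ∀ x y, N (x + y) ≤ N x + N y) (θ : Fin d → ℝ) :
    (∃ x, N x ≤ 1 ∧ dualNorm N θ = dotp θ x) ∧ ∀ x, N x ≤ 1 → dotp θ x ≤ dualNorm N θ := by
  have hz : N 0 = 0 := (hN0 0).2 rfl
  obtain ⟨x, hx, hmax⟩ := (norm_fun_unitBall_isCompact hN0 hNhom hNtri).exists_isMaxOn
    ⟨0, by simp [hz]⟩ (continuous_dotp θ).continuousOn
  have hgr : IsGreatest {r : ℝ | ∃ x : Fin d → ℝ, N x ≤ 1 ∧ r = dotp θ x} (dotp θ x) := by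
    refine ⟨⟨x, hx, rfl⟩, ?_⟩
    rintro r ⟨y, hy, rfl⟩
    exact hmax hy
  have he : dualNorm N θ = dotp θ x := hgr.csSup_eq
  exact ⟨⟨x, hx, he⟩, fun y hy => he ▸ hmax hy⟩

theorem dualNorm_nonneg (hN0 : ∀ x, N x = 0 ↔ x = 0)
    (hNhom : ∀ (a : ℝ) x, N (a • x) = |a| * N x)
    (hNtri : ∀ x y, N (x + y) ≤ N x + N y) (θ : Fin d → ℝ) : 0 ≤ dualNorm N θ := by
  have := (exists_dualNorm_eq hN0 hNhom hNtri θ).2 0 (by simp [(hN0 0).2 rfl])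
  simpa [dotp] using this

theorem abs_dotp_le (hN0 : ∀ x, N x = 0 ↔ x = 0)
    (hNhom : ∀ (a : ℝ) x, N (a • x) = |a| * N x)
    (hNtri : ∀ x y, N (x + y) ≤ N x + N y) (θ x : Fin d → ℝ) :
    |dotp θ x| ≤ dualNorm N θ * N x := by
  rcases eq_or_ne x 0 with rfl | hx
  · simp [dotp, (hN0 0).2 rfl]
  have hpos : 0 < N x := lt_of_le_of_ne (norm_fun_nonneg hN0 hNhom hNtri x)
    fun h => hx ((hN0 x).1 h.symm)
  have key : ∀ a : ℝ, |a| = 1 → a * dotp θ x ≤ dualNorm N θ * N x := by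
    intro a ha
    have h := (exists_dualNorm_eq hN0 hNhom hNtri θ).2 ((a / N x) • x) (by
      rw [hNhom, abs_div, ha, abs_of_pos hpos, one_div, inv_mul_cancel₀ hpos.ne'])
    rwa [dotp_smul, div_mul_eq_mul_div, div_le_iff₀ hpos] at h
  rw [abs_le']
  exact ⟨by simpa using key 1 (by simp), by simpa using key (-1) (by simp)⟩

theorem dualNorm_pos (hN0 : ∀ x, N x = 0 ↔ x = 0)
    (hNhom : ∀ (a : ℝ) x, N (a • x) = |a| * N x)
    (hNtri : ∀ x y, N (x + y) ≤ N x + N y) {θ : Fin d → ℝ} (hθ : θ ≠ 0) :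
    0 < dualNorm N θ := by
  have h := abs_dotp_le hN0 hNhom hNtri θ θ
  have hsq : 0 < dotp θ θ := by
    obtain ⟨i, hi⟩ := Function.ne_iff.1 hθ
    exact Finset.sum_pos' (fun j _ => mul_self_nonneg _)
      ⟨i, Finset.mem_univ i, mul_self_pos.2 hi⟩
  have hpos : 0 < dualNorm N θ * N θ := hsq.trans_le ((le_abs_self _).trans h)
  exact pos_of_mul_pos_left hpos (norm_fun_nonneg hN0 hNhom hNtri θ)

theorem exists_dotp_eq_one (hN0 : ∀ x, N x = 0 ↔ x = 0)
    (hNhom : ∀ (a : ℝ) x, N (a • x) = |a| * N x)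
    (hNtri : ∀ x y, N (x + y) ≤ N x + N y) {θ : Fin d → ℝ} (hθ : θ ≠ 0) :
    ∃ u, dotp θ u = 1 ∧ dualNorm N θ * N u ≤ 1 := by
  have hK := dualNorm_pos hN0 hNhom hNtri hθ
  obtain ⟨⟨x, hx, he⟩, -⟩ := exists_dualNorm_eq hN0 hNhom hNtri θ
  refine ⟨(dualNorm N θ)⁻¹ • x, ?_, ?_⟩
  · rw [dotp_smul, ← he, inv_mul_cancel₀ hK.ne']
  · rwa [hNhom, abs_of_pos (inv_pos.2 hK), mul_inv_cancel_left₀ hK.ne']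

end norm

section envelope

variable {ℓ : ℝ → ℝ} {p lam : ℝ}

theorem coe_le_pEnvelope (hp : 0 < p) (s : ℝ) :
    (ℓ s : EReal) ≤ pEnvelope (fun t => (ℓ t : EReal)) p s lam := by
  refine le_trans (le_of_eq ?_) (le_iSup _ s)
  simp [Real.zero_rpow hp.ne']

theorem coe_le_pEnvelope_add (s t : ℝ) :
    (ℓ t : EReal) ≤ pEnvelope (fun t => (ℓ t : EReal)) p s lam +
      ((lam * |s - t| ^ p : ℝ) : EReal) := by
  refine le_trans (le_of_eq ?_)
    (add_le_add_left (le_iSup (fun t => (ℓ t : EReal) - ((lam * |s - t| ^ p : ℝ) : EReal)) t) _)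
  norm_cast
  ring

/-- The envelope is the supremum of countably many of the functions that define it. -/
theorem exists_seq_pEnvelope_eq (hp : 0 ≤ p) (ℓ : ℝ → ℝ) (lam : ℝ) :
    ∃ σ : ℕ → ℝ, ∀ s, pEnvelope (fun t => (ℓ t : EReal)) p s lam =
      ⨆ n, ((ℓ (σ n) - lam * |s - σ n| ^ p : ℝ) : EReal) := by
  let F : ℝ → ℝ → EReal := fun t s => ((ℓ t - lam * |s - t| ^ p : ℝ) : EReal)
  have hF : ∀ t, Continuous (F t) := fun t =>
    continuous_coe_real_ereal.comp (continuous_const.sub (continuous_const.mul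
      ((continuous_id.sub continuous_const).abs.rpow_const fun _ => Or.inr hp)))
  obtain ⟨A, hA, hcount, hlub⟩ := exists_countable_lowerSemicontinuous_isLUB
    (s := ⨆ t, F t) (𝓕 := range F)
    (by rintro _ ⟨t, rfl⟩; exact (hF t).lowerSemicontinuous) isLUB_iSup
  have hne : A.Nonempty := by
    rw [Set.nonempty_iff_ne_empty]
    rintro rfl
    have h := hlub.unique isLUB_empty
    have h0 : F 0 0 ≤ (⨆ t, F t) 0 := le_iSup F 0 0
    rw [h] at h0
    exact EReal.coe_ne_bot _ (le_bot_iff.1 h0)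
  obtain ⟨f, hf⟩ := hcount.exists_eq_range hne
  have hmem : ∀ n, ∃ t, F t = f n := fun n => hA (hf ▸ mem_range_self n)
  choose σ hσ using hmem
  refine ⟨σ, fun s => ?_⟩
  have h1 : (⨆ t, F t) = ⨆ n, F (σ n) := by
    rw [hf] at hlub
    rw [← hlub.iSup_eq, funext hσ]
  have h2 := congrFun h1 s
  rw [iSup_apply, iSup_apply] at h2
  simpa only [pEnvelope, F, EReal.coe_sub] using h2

theorem measurable_pEnvelope (hp : 0 ≤ p) (ℓ : ℝ → ℝ) (lam : ℝ) :
    Measurable fun s => pEnvelope (fun t => (ℓ t : EReal)) p s lam := by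
  obtain ⟨σ, hσ⟩ := exists_seq_pEnvelope_eq hp ℓ lam
  simp only [hσ]
  refine Measurable.iSup fun n => measurable_coe_real_ereal.comp ?_
  fun_prop

/-- Upper semicontinuity and `p`-growth make the envelope at `0` tend to the function value. -/
theorem exists_pEnvelope_zero_le (hp : 0 < p) {C : ℝ} (hC : 0 ≤ C)
    (husc : UpperSemicontinuous fun t => (ℓ t : EReal))
    (hgrowth : ∀ s, ℓ s ≤ C * (1 + |s| ^ p)) {η : ℝ} (hη : 0 < η) :
    ∃ lam, 0 ≤ lam ∧ pEnvelope (fun t => (ℓ t : EReal)) p 0 lam ≤ ((ℓ 0 + η : ℝ) : EReal) := by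
  have hev := husc 0 ((ℓ 0 + η : ℝ) : EReal) (by
    simpa only [EReal.coe_lt_coe_iff, lt_add_iff_pos_right] using hη)
  obtain ⟨δ, hδ, hball⟩ := Metric.eventually_nhds_iff.1 hev
  have hδp : 0 < δ ^ p := Real.rpow_pos_of_pos hδ p
  have hlam : 0 ≤ C * (1 / δ ^ p + 1) + |ℓ 0| / δ ^ p := by positivity
  refine ⟨_, hlam, iSup_le fun t => ?_⟩
  rw [← EReal.coe_sub, EReal.coe_le_coe_iff, zero_sub, abs_neg]
  have ht : 0 ≤ |t| ^ p := by positivity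
  rcases lt_or_ge |t| δ with h | h
  · have h1 : ℓ t < ℓ 0 + η :=
      EReal.coe_lt_coe_iff.1 (hball (by simpa [Real.dist_eq] using h))
    have h2 := mul_nonneg hlam ht
    linarith
  · have h1 : δ ^ p ≤ |t| ^ p := Real.rpow_le_rpow hδ.le h hp.le
    have h2 : 1 ≤ |t| ^ p / δ ^ p := (one_le_div hδp).2 h1
    have h3 := hgrowth t
    have h4 := mul_le_mul_of_nonneg_left h2 hC
    have h5 := mul_le_mul_of_nonneg_left h2 (abs_nonneg (ℓ 0))
    have h6 := neg_abs_le (ℓ 0)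
    have h7 : (C * (1 / δ ^ p + 1) + |ℓ 0| / δ ^ p) * |t| ^ p =
        C * (|t| ^ p / δ ^ p) + C * |t| ^ p + |ℓ 0| * (|t| ^ p / δ ^ p) := by
      field_simp
    rw [h7]
    linarith

end envelope

section plans

variable {α : Type*} [MeasurableSpace α]

/-- The pairs `(a, r)` such that some transport plan onto `P` costs at most `a` and has a
first marginal under which `h` is integrable with mean at least `r`. -/
def attainablePairs (c : α → α → ℝ≥0∞) (P : Measure α) (h : α → ℝ) : Set (ℝ × ℝ) :=
  {q | 0 ≤ q.1 ∧ ∃ π : Measure (α × α), IsProbabilityMeasure π ∧ π.map Prod.snd = P ∧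
    ∫⁻ x, c x.1 x.2 ∂π ≤ ENNReal.ofReal q.1 ∧ Integrable (fun x => h x.1) π ∧
    q.2 ≤ ∫ x, h x.1 ∂π}

variable {c : α → α → ℝ≥0∞} {P : Measure α} {h : α → ℝ}

theorem attainablePairs_mono_left {a a' r : ℝ} (hq : (a, r) ∈ attainablePairs c P h)
    (haa : a ≤ a') : (a', r) ∈ attainablePairs c P h := by
  obtain ⟨h0, π, h1, h2, h3, h4⟩ := hq
  exact ⟨le_trans h0 haa, π, h1, h2, h3.trans (ENNReal.ofReal_le_ofReal haa), h4⟩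

theorem convex_attainablePairs : Convex ℝ (attainablePairs c P h) := by
  rintro ⟨a, r⟩ ⟨ha, π, hπ, hm, hc, hi, hr⟩ ⟨a', r'⟩ ⟨ha', π', hπ', hm', hc', hi', hr'⟩ s t hs ht hst
  dsimp only at ha ha' hc hc' hr hr'
  have hsum : ENNReal.ofReal s + ENNReal.ofReal t = 1 := by
    rw [← ENNReal.ofReal_add hs ht, hst, ENNReal.ofReal_one]
  have hi1 := hi.smul_measure (c := ENNReal.ofReal s) ENNReal.ofReal_ne_top
  have hi2 := hi'.smul_measure (c := ENNReal.ofReal t) ENNReal.ofReal_ne_top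
  refine ⟨by simpa using by positivity, ENNReal.ofReal s • π + ENNReal.ofReal t • π',
    ⟨by simp [hsum]⟩, ?_, ?_, hi1.add_measure hi2, ?_⟩
  · rw [Measure.map_add _ _ measurable_snd, Measure.map_smul, Measure.map_smul, hm, hm',
      ← add_smul, hsum, one_smul]
  · rw [lintegral_add_measure, lintegral_smul_measure, lintegral_smul_measure]
    simp only [Prod.smul_mk, Prod.mk_add_mk, smul_eq_mul]
    rw [ENNReal.ofReal_add (by positivity) (by positivity), ENNReal.ofReal_mul hs,
      ENNReal.ofReal_mul ht]
    gcongr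
  · rw [integral_add_measure hi1 hi2, integral_smul_measure, integral_smul_measure,
      ENNReal.toReal_ofReal hs, ENNReal.toReal_ofReal ht]
    simp only [Prod.smul_mk, Prod.mk_add_mk, smul_eq_mul]
    gcongr

end plans

/-- A supporting line at `ε` of a convex set of pairs whose values at `ε` are at most `v`. -/
theorem exists_supporting_slope {S : Set (ℝ × ℝ)} (hS : Convex ℝ S) {ε v r₀ : ℝ} (hε : 0 < ε)
    (hmono : ∀ a a' r, (a, r) ∈ S → a ≤ a' → (a', r) ∈ S) (h₀ : (0, r₀) ∈ S)
    (hv : ∀ r, (ε, r) ∈ S → r ≤ v) :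
    ∃ lam, 0 ≤ lam ∧ ∀ a r, (a, r) ∈ S → r ≤ v + lam * (a - ε) := by
  let T : Set ℝ := {x | ∃ a r, (a, r) ∈ S ∧ a < ε ∧ x = (v - r) / (ε - a)}
  have hT0 : ∀ x ∈ T, 0 ≤ x := by
    rintro _ ⟨a, r, har, ha, rfl⟩
    exact div_nonneg (sub_nonneg.2 (hv r (hmono a ε r har ha.le))) (sub_pos.2 ha).le
  have hTne : T.Nonempty := ⟨_, 0, r₀, h₀, hε, rfl⟩
  refine ⟨sInf T, Real.sInf_nonneg hT0, fun a r har => ?_⟩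
  rcases lt_trichotomy a ε with ha | rfl | ha
  · have h1 : sInf T ≤ (v - r) / (ε - a) := csInf_le ⟨0, hT0⟩ ⟨a, r, har, ha, rfl⟩
    rw [le_div_iff₀ (sub_pos.2 ha)] at h1
    linarith
  · simpa using hv r har
  · have h1 : (r - v) / (a - ε) ≤ sInf T := by
      refine le_csInf hTne ?_
      rintro _ ⟨a', r', har', ha', rfl⟩
      have hd : 0 < a - a' := by linarith
      have hmem := hS har har' (a := (ε - a') / (a - a')) (b := (a - ε) / (a - a'))
        (div_nonneg (by linarith) hd.le) (div_nonneg (by linarith) hd.le)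
        (by field_simp; ring)
      have he : ((ε - a') / (a - a')) • (a, r) + ((a - ε) / (a - a')) • (a', r') =
          (ε, ((ε - a') * r + (a - ε) * r') / (a - a')) := by
        ext
        · simp; field_simp; ring
        · simp; field_simp
      rw [he] at hmem
      have h2 := hv _ hmem
      rw [div_le_iff₀ hd] at h2
      rw [div_le_div_iff₀ (by linarith) (by linarith)]
      nlinarith
    rw [div_le_iff₀ (by linarith)] at h1
    linarith

section selection

variable {ℓ : ℝ → ℝ} {p lam : ℝ}

/-- Greedy maximisation of `t ↦ ℓ t − lam * |s − t| ^ p` over a sequence of candidates in which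
every `σ k` occurs infinitely often; the `n`-th candidate is considered only when `|s| ≤ n`. -/
def greedySelection (ℓ : ℝ → ℝ) (p lam : ℝ) (σ : ℕ → ℝ) : ℕ → ℝ → ℝ
  | 0, s => s
  | n + 1, s =>
    if |s| ≤ n ∧ ℓ (greedySelection ℓ p lam σ n s) - lam * |s - greedySelection ℓ p lam σ n s| ^ p <
        ℓ (σ n.unpair.1) - lam * |s - σ n.unpair.1| ^ p
    then σ n.unpair.1 else greedySelection ℓ p lam σ n s

variable {σ : ℕ → ℝ}

theorem measurableSet_greedySelection_step (hℓ : Measurable ℓ) (n : ℕ)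
    (hT : Measurable (greedySelection ℓ p lam σ n)) :
    MeasurableSet {s : ℝ | |s| ≤ n ∧
      ℓ (greedySelection ℓ p lam σ n s) - lam * |s - greedySelection ℓ p lam σ n s| ^ p <
        ℓ (σ n.unpair.1) - lam * |s - σ n.unpair.1| ^ p} := by
  have hlt : MeasurableSet {s : ℝ |
      ℓ (greedySelection ℓ p lam σ n s) - lam * |s - greedySelection ℓ p lam σ n s| ^ p <
        ℓ (σ n.unpair.1) - lam * |s - σ n.unpair.1| ^ p} :=
    measurableSet_lt (by fun_prop) (by fun_prop)
  exact (measurableSet_le continuous_abs.measurable measurable_const).inter hlt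

theorem measurable_greedySelection (hℓ : Measurable ℓ) (n : ℕ) :
    Measurable (greedySelection ℓ p lam σ n) := by
  induction n with
  | zero => exact measurable_id
  | succ n ih =>
    exact Measurable.ite (measurableSet_greedySelection_step hℓ n ih) measurable_const ih

theorem integrable_greedySelection {ν : Measure ℝ} [IsFiniteMeasure ν] (hℓ : Measurable ℓ)
    (hp : 0 < p) (hi : Integrable ℓ ν) (n : ℕ) :
    Integrable (fun s => ℓ (greedySelection ℓ p lam σ n s)) ν ∧
      Integrable (fun s => |s - greedySelection ℓ p lam σ n s| ^ p) ν := by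
  induction n with
  | zero => simpa [greedySelection, Real.zero_rpow hp.ne'] using hi
  | succ n ih =>
    have hm := measurableSet_greedySelection_step (p := p) (lam := lam) (σ := σ) hℓ n
      (measurable_greedySelection hℓ n)
    have hTm : Measurable (greedySelection ℓ p lam σ (n + 1)) := measurable_greedySelection hℓ _
    constructor
    · refine Integrable.mono' (ih.1.norm.add (integrable_const ‖ℓ (σ n.unpair.1)‖))
        (hℓ.comp hTm).aestronglyMeasurable (ae_of_all _ fun s => ?_)
      simp only [greedySelection, Pi.add_apply]
      split_ifs
      · exact le_add_of_nonneg_left (norm_nonneg _)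
      · exact le_add_of_nonneg_right (norm_nonneg _)
    · refine Integrable.mono' (ih.2.add (integrable_const ((n + |σ n.unpair.1|) ^ p)))
        ((measurable_id.sub hTm).abs.pow_const p).aestronglyMeasurable (ae_of_all _ fun s => ?_)
      rw [Real.norm_of_nonneg (by positivity)]
      simp only [greedySelection, Pi.add_apply]
      split_ifs with h
      · refine le_add_of_nonneg_of_le (by positivity) (Real.rpow_le_rpow (abs_nonneg _) ?_ hp.le)
        exact (abs_sub _ _).trans (add_le_add_left h.1 _)
      · exact le_add_of_nonneg_right (by positivity)

theorem greedySelection_value_monotone (s : ℝ) :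
    Monotone fun n => ℓ (greedySelection ℓ p lam σ n s) -
      lam * |s - greedySelection ℓ p lam σ n s| ^ p := by
  refine monotone_nat_of_le_succ fun n => ?_
  simp only [greedySelection]
  split_ifs with h
  · exact h.2.le
  · exact le_rfl

theorem exists_le_greedySelection_value (s : ℝ) (k : ℕ) :
    ∃ n, ℓ (σ k) - lam * |s - σ k| ^ p ≤ ℓ (greedySelection ℓ p lam σ n s) -
      lam * |s - greedySelection ℓ p lam σ n s| ^ p := by
  obtain ⟨m, hm⟩ := exists_nat_ge |s|
  refine ⟨Nat.pair k m + 1, ?_⟩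
  have hs : |s| ≤ (Nat.pair k m : ℕ) := hm.trans (by exact_mod_cast Nat.right_le_pair k m)
  simp only [greedySelection, Nat.unpair_pair]
  split_ifs with h
  · exact le_rfl
  · exact not_lt.1 fun h' => h ⟨hs, h'⟩

/-- Interchange of supremum and integral for the envelope: it suffices to bound the
penalised value of every transport map. -/
theorem eint_pEnvelope_le {ν : Measure ℝ} [IsFiniteMeasure ν] (hℓ : Measurable ℓ) (hp : 0 < p)
    (hi : Integrable ℓ ν) {B : ℝ}
    (hB : ∀ T : ℝ → ℝ, Measurable T → Integrable (fun s => ℓ (T s)) ν →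
      Integrable (fun s => |s - T s| ^ p) ν →
      ∫ s, ℓ (T s) ∂ν - lam * ∫ s, |s - T s| ^ p ∂ν ≤ B) :
    eint ν (fun s => pEnvelope (fun t => (ℓ t : EReal)) p s lam) ≤ (B : EReal) := by
  obtain ⟨σ, hσ⟩ := exists_seq_pEnvelope_eq hp.le ℓ lam
  let G : ℕ → ℝ → ℝ := fun n s => ℓ (greedySelection ℓ p lam σ n s) -
    lam * |s - greedySelection ℓ p lam σ n s| ^ p
  have hG0 : ∀ s, G 0 s = ℓ s := fun s => by
    simp [G, greedySelection, Real.zero_rpow hp.ne']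
  have hmono : ∀ s, Monotone fun n => G n s := greedySelection_value_monotone
  have hle : ∀ n s, ℓ s ≤ G n s := fun n s => hG0 s ▸ hmono s (Nat.zero_le n)
  have hGi : ∀ n, Integrable (G n) ν := fun n =>
    (integrable_greedySelection hℓ hp hi n).1.sub
      ((integrable_greedySelection hℓ hp hi n).2.const_mul lam)
  have hGB : ∀ n, ∫ s, G n s ∂ν ≤ B := fun n => by
    obtain ⟨h1, h2⟩ := integrable_greedySelection (lam := lam) (σ := σ) hℓ hp hi n
    have h3 := hB _ (measurable_greedySelection hℓ n) h1 h2
    rwa [← integral_const_mul, ← integral_sub h1 (h2.const_mul lam)] at h3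
  have hm : ∀ n, Measurable fun s => ENNReal.ofReal (G n s - ℓ s) := fun n => by
    have := measurable_greedySelection (p := p) (lam := lam) (σ := σ) hℓ n
    fun_prop
  have hlin : ∫⁻ s, ⨆ n, ENNReal.ofReal (G n s - ℓ s) ∂ν ≤ ENNReal.ofReal (B - ∫ s, ℓ s ∂ν) := by
    rw [lintegral_iSup hm fun m n hmn s =>
      ENNReal.ofReal_le_ofReal (sub_le_sub_right (hmono s hmn) _)]
    refine iSup_le fun n => ?_
    have hGℓ : Integrable (fun s => G n s - ℓ s) ν := (hGi n).sub hi
    rw [← ofReal_integral_eq_lintegral_ofReal hGℓ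
      (ae_of_all _ fun s => sub_nonneg.2 (hle n s)), integral_sub (hGi n) hi]
    exact ENNReal.ofReal_le_ofReal (sub_le_sub_right (hGB n) _)
  have hB0 : ∫ s, ℓ s ∂ν ≤ B := by simpa only [hG0] using hGB 0
  refine (eint_le_integral_add_lintegral hi (k := fun s => ⨆ n, ENNReal.ofReal (G n s - ℓ s))
    (Measurable.iSup hm).aemeasurable (ae_of_all _ fun s => ?_)).trans ?_
  · rw [hσ]
    refine iSup_le fun k => ?_
    obtain ⟨n, hn⟩ := exists_le_greedySelection_value (ℓ := ℓ) (p := p) (lam := lam) (σ := σ) s k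
    calc ((ℓ (σ k) - lam * |s - σ k| ^ p : ℝ) : EReal)
        ≤ ((ℓ s + (G n s - ℓ s) : ℝ) : EReal) := by
          rw [EReal.coe_le_coe_iff, add_sub_cancel]; exact hn
      _ ≤ (ℓ s : EReal) + ((ENNReal.ofReal (G n s - ℓ s) : ℝ≥0∞) : EReal) := by
          rw [EReal.coe_add, EReal.coe_ennreal_ofReal]
          gcongr
          exact_mod_cast le_max_left _ _
      _ ≤ _ := by
          gcongr
          exact EReal.coe_ennreal_le_coe_ennreal_iff.2
            (le_iSup (fun n => ENNReal.ofReal (G n s - ℓ s)) n)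
  · calc _ ≤ ((∫ s, ℓ s ∂ν : ℝ) : EReal) + ((ENNReal.ofReal (B - ∫ s, ℓ s ∂ν) : ℝ≥0∞) : EReal) := by
          gcongr
          exact EReal.coe_ennreal_le_coe_ennreal_iff.2 hlin
      _ = (B : EReal) := by
          rw [EReal.coe_ennreal_ofReal, max_eq_left (sub_nonneg.2 hB0), ← EReal.coe_add,
            add_sub_cancel]

end selection

theorem erealPos_mono : Monotone erealPos := by
  intro x y hxy
  induction y with
  | top => simp [erealPos]
  | bot => rw [le_bot_iff.1 hxy]
  | coe y =>
    induction x with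
    | top => simp at hxy
    | bot => simp [erealPos]
    | coe x =>
      rw [erealPos_coe, erealPos_coe]
      exact ENNReal.ofReal_le_ofReal (EReal.coe_le_coe_iff.1 hxy)

theorem OTDiscrepancy_le {α : Type*} [MeasurableSpace α] (c : α → α → ℝ≥0∞) {Q P : Measure α}
    {π : Measure (α × α)} (hQ : π.map Prod.fst = Q) (hP : π.map Prod.snd = P) :
    OTDiscrepancy c Q P ≤ ∫⁻ x, c x.1 x.2 ∂π :=
  iInf₂_le (f := fun (π : Measure (α × α)) (_ : π ∈ couplings Q P) => ∫⁻ x, c x.1 x.2 ∂π)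
    π ⟨hQ, hP⟩

/-- Weak duality for a dual variable `a ≥ 0` and a dual function `f`. -/
theorem eint_le_of_mem_ambiguitySet {α : Type*} [MeasurableSpace α] {c : α → α → ℝ}
    (hc : Measurable fun x : α × α => c x.1 x.2) (hc0 : ∀ x y, 0 ≤ c x y)
    {P Q : ProbabilityMeasure α} {h : α → ℝ} (hh : Measurable h) {f : α → EReal}
    (hf : Measurable f) (hneg : ∫⁻ x, erealPos (-(f x)) ∂P.toMeasure ≠ ⊤) {a ε : ℝ} (ha : 0 ≤ a)
    (hε : 0 ≤ ε) (hle : ∀ x y, (h x : EReal) ≤ f y + ((a * c x y : ℝ) : EReal))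
    (hQ : Q ∈ ambiguitySet (fun x y => ENNReal.ofReal (c x y)) P ε) :
    eint Q.toMeasure (fun x => (h x : EReal)) ≤ ((a * ε : ℝ) : EReal) + eint P.toMeasure f := by
  rcases eq_or_ne (∫⁻ x, erealPos (f x) ∂P.toMeasure) ⊤ with hpos | hpos
  · have htop : eint P.toMeasure f = ⊤ := by
      lift (∫⁻ x, erealPos (-(f x)) ∂P.toMeasure) to NNReal using hneg with B hB
      rw [eint, hpos, ← hB, EReal.coe_nnreal_eq_coe_real, EReal.coe_ennreal_top, EReal.top_sub_coe]
    rw [htop, EReal.coe_add_top]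
    exact le_top
  obtain ⟨g, hg, hgf⟩ := exists_integrable_ae_eq hf hpos hneg
  have hfg : eint P.toMeasure f = ((∫ x, g x ∂P.toMeasure : ℝ) : EReal) := by
    rw [← eint_coe hg]
    unfold eint
    congr 2 <;> refine lintegral_congr_ae (hgf.mono fun x hx => ?_) <;> simp only [hx]
  have key : ∀ δ : ℝ, 0 < δ → eint Q.toMeasure (fun x => (h x : EReal)) ≤
      ((a * (ε + δ) + ∫ x, g x ∂P.toMeasure : ℝ) : EReal) := by
    intro δ hδ
    have hlt : OTDiscrepancy (fun x y => ENNReal.ofReal (c x y)) Q.toMeasure P.toMeasure <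
        ENNReal.ofReal (ε + δ) :=
      lt_of_le_of_lt hQ ((ENNReal.ofReal_lt_ofReal_iff (by linarith)).2 (by linarith))
    simp only [OTDiscrepancy, iInf_lt_iff] at hlt
    obtain ⟨π, ⟨hπQ, hπP⟩, hcost⟩ := hlt
    have hgi : Integrable (fun x : α × α => g x.2) π := by
      rw [← hπP] at hg
      exact hg.comp_measurable measurable_snd
    have hgint : ∫ x, g x.2 ∂π = ∫ x, g x ∂P.toMeasure := by
      rw [← hπP] at hg ⊢
      exact (integral_map measurable_snd.aemeasurable hg.aestronglyMeasurable).symm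
    have hae : ∀ᵐ x ∂π, f x.2 = (g x.2 : EReal) := by
      rw [← hπP] at hgf
      exact ae_of_ae_map measurable_snd.aemeasurable hgf
    rw [← hπQ, eint_map (f := fun x => (h x : EReal)) measurable_fst
      (measurable_coe_real_ereal.comp hh)]
    refine (eint_le_integral_add_lintegral hgi
      (k := fun x => ENNReal.ofReal a * ENNReal.ofReal (c x.1 x.2))
      (hc.ennreal_ofReal.const_mul _).aemeasurable (hae.mono fun x hx => ?_)).trans ?_
    · rw [← ENNReal.ofReal_mul ha, EReal.coe_ennreal_ofReal,
        max_eq_left (by exact_mod_cast mul_nonneg ha (hc0 _ _)), ← hx]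
      exact hle _ _
    · rw [hgint, lintegral_const_mul _ hc.ennreal_ofReal, add_comm (a * (ε + δ)), EReal.coe_add]
      gcongr
      have : ((a * (ε + δ) : ℝ) : EReal) = ((ENNReal.ofReal (a * (ε + δ)) : ℝ≥0∞) : EReal) := by
        rw [EReal.coe_ennreal_ofReal, max_eq_left (by positivity)]
      rw [this, EReal.coe_ennreal_le_coe_ennreal_iff, ENNReal.ofReal_mul ha]
      gcongr
  rw [hfg, ← EReal.coe_add]
  refine le_of_forall_gt_imp_ge_of_dense fun b hb => ?_
  obtain ⟨r, hr, hrb⟩ := EReal.lt_iff_exists_real_btwn.1 hb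
  rw [EReal.coe_lt_coe_iff] at hr
  have hd : 0 < (r - (a * ε + ∫ x, g x ∂P.toMeasure)) / (a + 1) :=
    div_pos (by linarith) (by linarith)
  refine (key _ hd).trans (le_trans ?_ hrb.le)
  rw [EReal.coe_le_coe_iff]
  have h1 : (r - (a * ε + ∫ x, g x ∂P.toMeasure)) / (a + 1) * (a + 1) =
      r - (a * ε + ∫ x, g x ∂P.toMeasure) := div_mul_cancel₀ _ (by linarith)
  nlinarith

/-- **Strong duality for DRO over linear hypotheses with norm-power costs.**
For `c(z, ẑ) = ‖z − ẑ‖^p`, a proper upper semicontinuous loss `L` with growth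
`L(s) ≤ C(1 + |s|^p)`, a `P̂`-integrable linear loss and `ε > 0`, the worst-case expected
loss equals `inf_{λ ≥ 0} λ ε ‖θ‖_*^p + ∫ L_p(⟨θ, ẑ⟩, λ) dP̂`. -/
theorem envelope_strong_duality {d : ℕ}
    (N : (Fin d → ℝ) → ℝ)
    (hN0 : ∀ x, N x = 0 ↔ x = 0)
    (hNhom : ∀ (a : ℝ) x, N (a • x) = |a| * N x)
    (hNtri : ∀ x y, N (x + y) ≤ N x + N y)
    (p : ℝ) (hp : 1 ≤ p)
    (L : ℝ → EReal)
    (hLproper : (∀ s, L s ≠ ⊥) ∧ (∃ s, L s ≠ ⊤))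
    (hLusc : UpperSemicontinuous L)
    (C : ℝ) (hC : 0 ≤ C) (hLgrowth : ∀ s : ℝ, L s ≤ ((C * (1 + |s| ^ p) : ℝ) : EReal))
    (Phat : ProbabilityMeasure (Fin d → ℝ))
    (θ : Fin d → ℝ)
    (hint : (∫⁻ z, erealPos (L (dotp θ z)) ∂Phat.toMeasure) ≠ ⊤ ∧
      (∫⁻ z, erealPos (-(L (dotp θ z))) ∂Phat.toMeasure) ≠ ⊤)
    (ε : ℝ) (hε : 0 < ε) :
    (⨆ Q ∈ ambiguitySet
        (fun z zhat : Fin d → ℝ => ENNReal.ofReal (N (z - zhat) ^ p)) Phat ε,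
      eint Q.toMeasure (fun z => L (dotp θ z))) =
    (⨅ lam ∈ {lam : ℝ | 0 ≤ lam},
      ((lam * ε * dualNorm N θ ^ p : ℝ) : EReal) +
        eint Phat.toMeasure (fun zhat => pEnvelope L p (dotp θ zhat) lam)) := by
  obtain ⟨ℓ, rfl⟩ : ∃ ℓ : ℝ → ℝ, L = fun s => (ℓ s : EReal) :=
    ⟨fun s => (L s).toReal, funext fun s => (EReal.coe_toReal
      (ne_top_of_le_ne_top (EReal.coe_ne_top _) (hLgrowth s)) (hLproper.1 s)).symm⟩
  have hp0 : 0 < p := by linarith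
  have hN := norm_fun_nonneg hN0 hNhom hNtri
  have hNcont := norm_fun_continuous hNhom hNtri
  have hK := dualNorm_nonneg hN0 hNhom hNtri θ
  have hℓ : Measurable ℓ := hLusc.measurable.ereal_toReal
  have hθm : Measurable (dotp θ) := (continuous_dotp θ).measurable
  have hcm : Measurable fun x : (Fin d → ℝ) × (Fin d → ℝ) => N (x.1 - x.2) ^ p :=
    (hNcont.measurable.comp (measurable_fst.sub measurable_snd)).pow_const p
  have hc0 : ∀ x y : Fin d → ℝ, 0 ≤ N (x - y) ^ p := fun x y => Real.rpow_nonneg (hN _) p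
  have hκ : 0 ≤ dualNorm N θ ^ p := Real.rpow_nonneg hK p
  have hi : Integrable (fun z => ℓ (dotp θ z)) Phat.toMeasure := by
    obtain ⟨g, hg, hgf⟩ := exists_integrable_ae_eq
      (measurable_coe_real_ereal.comp (hℓ.comp hθm)) hint.1 hint.2
    exact hg.congr (hgf.mono fun z hz => (EReal.coe_injective hz).symm)
  apply le_antisymm
  · refine iSup₂_le fun Q hQ => le_iInf₂ fun lam hlam => ?_
    have hlam : 0 ≤ lam := hlam
    have h := eint_le_of_mem_ambiguitySet hcm hc0 (hℓ.comp hθm)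
      ((measurable_pEnvelope hp0.le ℓ lam).comp hθm)
      (ne_top_of_le_ne_top hint.2 (lintegral_mono fun z => erealPos_mono
        (EReal.neg_le_neg_iff.2 (coe_le_pEnvelope hp0 _))))
      (mul_nonneg hlam hκ) hε.le (fun x y => ?_) hQ
    · rw [mul_right_comm] at h
      exact h
    · refine (coe_le_pEnvelope_add (p := p) (lam := lam) (dotp θ y) (dotp θ x)).trans
        (add_le_add le_rfl ?_)
      rw [EReal.coe_le_coe_iff, mul_assoc, ← Real.mul_rpow hK (hN _), abs_sub_comm, ← dotp_sub]
      gcongr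
      exact abs_dotp_le hN0 hNhom hNtri θ _
  have hself : Phat ∈ ambiguitySet
      (fun z zhat : Fin d → ℝ => ENNReal.ofReal (N (z - zhat) ^ p)) Phat ε := by
    have hdiag : Measurable fun z : Fin d → ℝ => (z, z) := measurable_id.prodMk measurable_id
    refine (OTDiscrepancy_le (π := Phat.toMeasure.map fun z => (z, z)) _ ?_ ?_).trans ?_
    · rw [Measure.map_map measurable_fst hdiag]
      exact Measure.map_id
    · rw [Measure.map_map measurable_snd hdiag]
      exact Measure.map_id
    · rw [lintegral_map hcm.ennreal_ofReal hdiag]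
      simp [(hN0 0).2 rfl, Real.zero_rpow hp0.ne']
  rcases eq_or_ne θ 0 with rfl | hθ
  · have hdot : ∀ z : Fin d → ℝ, dotp 0 z = 0 := fun z => by simp [dotp]
    have hdual : dualNorm N 0 = 0 := by
      obtain ⟨⟨x, -, hx⟩, -⟩ := exists_dualNorm_eq hN0 hNhom hNtri 0
      rw [hx, hdot]
    refine le_trans ?_ (le_iSup₂ (f := fun (Q : ProbabilityMeasure (Fin d → ℝ)) _ =>
      eint Q.toMeasure fun z => ((ℓ (dotp 0 z) : ℝ) : EReal)) Phat hself)
    simp only [hdot, hdual, Real.zero_rpow hp0.ne', mul_zero, EReal.coe_zero, zero_add]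
    rw [eint_coe (integrable_const _), integral_const, probReal_univ, one_smul]
    refine le_of_forall_gt_imp_ge_of_dense fun b hb => ?_
    obtain ⟨r, hr, hrb⟩ := EReal.lt_iff_exists_real_btwn.1 hb
    rw [EReal.coe_lt_coe_iff] at hr
    obtain ⟨lam, hlam, hle⟩ := exists_pEnvelope_zero_le hp0 hC hLusc
      (fun s => EReal.coe_le_coe_iff.1 (hLgrowth s)) (sub_pos.2 hr)
    refine (iInf₂_le lam hlam).trans (le_trans ?_ hrb.le)
    have h := eint_le_integral_add_lintegral (μ := Phat.toMeasure)
      (f := fun _ => pEnvelope (fun t => (ℓ t : EReal)) p 0 lam) (k := fun _ => 0)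
      (integrable_const r) aemeasurable_const (ae_of_all _ fun _ => by simpa using hle)
    simpa using h
  · set v := ⨆ Q ∈ ambiguitySet
        (fun z zhat : Fin d → ℝ => ENNReal.ofReal (N (z - zhat) ^ p)) Phat ε,
      eint Q.toMeasure (fun z => ((ℓ (dotp θ z) : ℝ) : EReal)) with hv
    rcases eq_or_ne v ⊤ with hvt | hvt
    · rw [hvt]; exact le_top
    have hvb : v ≠ ⊥ := by
      have h1 : eint Phat.toMeasure (fun z => ((ℓ (dotp θ z) : ℝ) : EReal)) ≤ v :=
        le_iSup₂ (f := fun (Q : ProbabilityMeasure (Fin d → ℝ)) _ =>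
          eint Q.toMeasure fun z => ((ℓ (dotp θ z) : ℝ) : EReal)) Phat hself
      rw [eint_coe hi] at h1
      exact ne_bot_of_le_ne_bot (EReal.coe_ne_bot _) h1
    lift v to ℝ using ⟨hvt, hvb⟩ with w
    have hplan : ∀ r, (ε, r) ∈ attainablePairs
        (fun z zhat : Fin d → ℝ => ENNReal.ofReal (N (z - zhat) ^ p)) Phat.toMeasure
        (fun z => ℓ (dotp θ z)) → r ≤ w := by
      rintro r ⟨-, π, hπ, hπP, hcost, hπi, hr⟩
      have hQ : IsProbabilityMeasure (π.map Prod.fst) :=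
        Measure.isProbabilityMeasure_map measurable_fst.aemeasurable
      have h1 : eint (π.map Prod.fst) (fun z => ((ℓ (dotp θ z) : ℝ) : EReal)) ≤ (w : EReal) := by
        rw [hv]
        exact le_iSup₂ (f := fun (Q : ProbabilityMeasure (Fin d → ℝ)) _ =>
          eint Q.toMeasure fun z => ((ℓ (dotp θ z) : ℝ) : EReal)) ⟨π.map Prod.fst, hQ⟩
          ((OTDiscrepancy_le _ rfl hπP).trans hcost)
      rw [eint_map (f := fun z => ((ℓ (dotp θ z) : ℝ) : EReal)) measurable_fst
        (measurable_coe_real_ereal.comp (hℓ.comp hθm)), eint_coe hπi,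
        EReal.coe_le_coe_iff] at h1
      exact hr.trans h1
    obtain ⟨u, hu1, hu2⟩ := exists_dotp_eq_one hN0 hNhom hNtri hθ
    have hκpos : 0 < dualNorm N θ ^ p := Real.rpow_pos_of_pos (dualNorm_pos hN0 hNhom hNtri hθ) p
    have hup : N u ^ p ≤ (dualNorm N θ ^ p)⁻¹ := by
      rw [← one_div, le_div_iff₀ hκpos, mul_comm, ← Real.mul_rpow hK (hN u)]
      exact Real.rpow_le_one (mul_nonneg hK (hN u)) hu2 hp0.le
    have hθam := hθm.aemeasurable (μ := Phat.toMeasure)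
    have hmem : ∀ T : ℝ → ℝ, Measurable T →
        Integrable (fun s => ℓ (T s)) (Phat.toMeasure.map (dotp θ)) →
        Integrable (fun s => |s - T s| ^ p) (Phat.toMeasure.map (dotp θ)) →
        ((dualNorm N θ ^ p)⁻¹ * ∫ s, |s - T s| ^ p ∂(Phat.toMeasure.map (dotp θ)),
          ∫ s, ℓ (T s) ∂(Phat.toMeasure.map (dotp θ))) ∈ attainablePairs
        (fun z zhat : Fin d → ℝ => ENNReal.ofReal (N (z - zhat) ^ p)) Phat.toMeasure
        (fun z => ℓ (dotp θ z)) := by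
      intro T hT hT1 hT2
      have hΦ : Measurable fun z : Fin d → ℝ => (z + (T (dotp θ z) - dotp θ z) • u, z) :=
        (measurable_id.add (((hT.comp hθm).sub hθm).smul_const u)).prodMk measurable_id
      have hdot : ∀ z, dotp θ (z + (T (dotp θ z) - dotp θ z) • u) = T (dotp θ z) := fun z => by
        rw [dotp_add, dotp_smul, hu1]; ring
      have hint1 := integral_map hθam hT1.aestronglyMeasurable
      have hint2 := integral_map hθam hT2.aestronglyMeasurable
      have hT1' : Integrable (fun z => ℓ (T (dotp θ z))) Phat.toMeasure :=
        hT1.comp_measurable hθm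
      have hT2' : Integrable (fun z => |dotp θ z - T (dotp θ z)| ^ p) Phat.toMeasure :=
        hT2.comp_measurable hθm
      have hfst : Measurable fun x : (Fin d → ℝ) × (Fin d → ℝ) => ℓ (dotp θ x.1) :=
        hℓ.comp (hθm.comp measurable_fst)
      refine ⟨mul_nonneg (inv_nonneg.2 hκ) (integral_nonneg fun s => by positivity),
        Phat.toMeasure.map fun z => (z + (T (dotp θ z) - dotp θ z) • u, z),
        Measure.isProbabilityMeasure_map hΦ.aemeasurable, ?_, ?_, ?_, ?_⟩
      · rw [Measure.map_map measurable_snd hΦ]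
        exact Measure.map_id
      · rw [lintegral_map hcm.ennreal_ofReal hΦ]
        dsimp only
        rw [hint2, ← integral_const_mul, ofReal_integral_eq_lintegral_ofReal
          (hT2'.const_mul _) (ae_of_all _ fun z => by positivity)]
        refine lintegral_mono fun z => ENNReal.ofReal_le_ofReal ?_
        rw [add_sub_cancel_left, hNhom, Real.mul_rpow (abs_nonneg _) (hN u), abs_sub_comm, mul_comm]
        gcongr
      · rw [integrable_map_measure hfst.aestronglyMeasurable hΦ.aemeasurable]
        simpa only [Function.comp_def, hdot] using hT1'
      · rw [integral_map hΦ.aemeasurable hfst.aestronglyMeasurable]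
        simp only [hdot]
        exact hint1.le
    have hiν : Integrable ℓ (Phat.toMeasure.map (dotp θ)) :=
      (integrable_map_measure hℓ.aestronglyMeasurable hθam).2 hi
    have h00 := hmem id measurable_id hiν (by simp [Real.zero_rpow hp0.ne'])
    simp only [id, sub_self, abs_zero, Real.zero_rpow hp0.ne', integral_zero, mul_zero] at h00
    obtain ⟨lam, hlam, hslope⟩ := exists_supporting_slope convex_attainablePairs hε
      (fun _ _ _ => attainablePairs_mono_left) h00 hplan
    have hdual0 : 0 ≤ lam * (dualNorm N θ ^ p)⁻¹ := mul_nonneg hlam (inv_nonneg.2 hκ)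
    refine (iInf₂_le (lam * (dualNorm N θ ^ p)⁻¹) hdual0).trans ?_
    have := Measure.isProbabilityMeasure_map hθam
    have henv := eint_pEnvelope_le (lam := lam * (dualNorm N θ ^ p)⁻¹) (B := w - lam * ε)
      hℓ hp0 hiν fun T hT hT1 hT2 => by
        have h := hslope _ _ (hmem T hT hT1 hT2)
        linarith
    rw [eint_map hθm (measurable_pEnvelope hp0.le ℓ _)] at henv
    calc _ ≤ ((lam * (dualNorm N θ ^ p)⁻¹ * ε * dualNorm N θ ^ p : ℝ) : EReal) +
          ((w - lam * ε : ℝ) : EReal) := by gcongr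
      _ = (w : EReal) := by
        rw [← EReal.coe_add]
        congr 1
        field_simp
        ring
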